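/- For all binary trees t1 with m nodes and t2 with n nodes (possibly empty), the convolution bracket c_{t1}⋆c_{t2} − c_{t2}⋆c_{t1} lies in the linear span of { c_t : t a binary tree with m+n+1 nodes }; that is, the elements c_t span a Lie subalgebra of (⊕_n ℚ[S_n], [·,·]_⋆). -/

import Mathlib

/-- The free module on words of positive integers, with coefficients in `R`.
`ℚ[S_n]` is identified with the span of the permutation words of {1,…,n}. -/
abbrev FW (R : Type) [CommRing R] := (List ℕ) →₀ R

variable {R : Type} [CommRing R]

/-- Concatenation product, extended bilinearly. -/
noncomputable def catW (x y : FW R) : FW R :=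
  x.sum fun u a => y.sum fun v b => Finsupp.single (u ++ v) (a * b)

/-- The bracket [x,y] = x·y − y·x of the concatenation product. -/
noncomputable def brakW (x y : FW R) : FW R := catW x y - catW y x

/-- (Incomplete) binary trees; `nil` is the empty tree. The complete binary tree with
`t.nodes + 1` leaves whose internal nodes form `t` is implicit in the definitions below. -/
inductive BT
  | nil : BT
  | nd : BT → BT → BT
deriving DecidableEq

/-- Number of nodes of a binary tree. -/
def BT.nodes : BT → ℕ
  | .nil => 0
  | .nd l r => l.nodes + r.nodes + 1

/-- The evaluation T(σ) of the complete binary tree `T` whose internal nodes form `t`, with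
leaves labelled left to right by the word `w`: each leaf gets the one-letter word of its label
and each internal node the bracket of concatenation. -/
noncomputable def evalBT : BT → List ℕ → FW R
  | .nil, w => Finsupp.single w 1
  | .nd l r, w => brakW (evalBT l (w.take (l.nodes + 1))) (evalBT r (w.drop (l.nodes + 1)))

/-- The standardization of a word with distinct letters: each letter is replaced by its rank. -/
def stdW (w : List ℕ) : List ℕ := w.map fun x => (w.filter (· ≤ x)).length

/-- The set of permutation words of {1, …, n}. -/
def permWords (n : ℕ) : Finset (List ℕ) := (List.range' 1 n).permutations.toFinset

/-- Convolution α⋆β of two permutation words: the sum of all permutation words γ of size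
|α|+|β| with std(γ(1)⋯γ(m)) = α and std(γ(m+1)⋯γ(m+n)) = β. -/
noncomputable def convW (u v : List ℕ) : FW R :=
  ∑ γ ∈ (permWords (u.length + v.length)).filter
      (fun γ => stdW (γ.take u.length) = u ∧ stdW (γ.drop u.length) = v),
    Finsupp.single γ 1

/-- The convolution product, extended bilinearly. -/
noncomputable def starW (x y : FW R) : FW R :=
  x.sum fun u a => y.sum fun v b => (a * b) • convW u v

/-- Whether the word `w` is an admissible labelling of (the completion of) `t`: at each internal
node, the smallest label lies in the left subtree and the largest in the right subtree. -/
def admB : BT → List ℕ → Bool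
  | .nil, _ => true
  | .nd l r, w =>
    admB l (w.take (l.nodes + 1)) && admB r (w.drop (l.nodes + 1))
      && decide ((w.take (l.nodes + 1)).minimum = w.minimum)
      && decide ((w.drop (l.nodes + 1)).maximum = w.maximum)

/-- c_t: the sum of the evaluations T(σ) over all admissible labellings σ of the complete
binary tree whose internal nodes form `t`. -/
noncomputable def cElt (t : BT) : FW R :=
  ∑ w ∈ (permWords (t.nodes + 1)).filter (fun w => admB t w = true), evalBT t w



/-- Concatenation as a bilinear map. -/
noncomputable def catL (R : Type) [CommRing R] : FW R →ₗ[R] FW R →ₗ[R] FW R :=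
  Finsupp.lift _ R _ fun u => Finsupp.lmapDomain R R (u ++ ·)

theorem catL_apply (x y : FW R) : catL R x y = catW x y := by
  simp only [catL, catW, Finsupp.lift_apply, Finsupp.sum, LinearMap.sum_apply,
    LinearMap.smul_apply, Finsupp.lmapDomain_apply, Finsupp.mapDomain, Finset.smul_sum,
    Finsupp.smul_single, smul_eq_mul]

theorem catW_single (u v : List ℕ) (a b : R) :
    catW (Finsupp.single u a) (Finsupp.single v b) = Finsupp.single (u ++ v) (a * b) := by
  simp [catW]

theorem catW_assoc (x y z : FW R) : catW (catW x y) z = catW x (catW y z) := by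
  simp only [← catL_apply]
  induction x using Finsupp.induction_linear with
  | zero => simp
  | add x x' hx hx' => simp only [map_add, LinearMap.add_apply, hx, hx']
  | single u a =>
  induction y using Finsupp.induction_linear with
  | zero => simp
  | add y y' hy hy' => simp only [map_add, LinearMap.add_apply, hy, hy']
  | single v b =>
  induction z using Finsupp.induction_linear with
  | zero => simp
  | add z z' hz hz' => simp only [map_add, hz, hz']
  | single w c => simp only [catL_apply, catW_single, mul_assoc, List.append_assoc]

/-- The concatenation bracket as a bilinear map. -/
noncomputable def brakL (R : Type) [CommRing R] : FW R →ₗ[R] FW R →ₗ[R] FW R :=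
  LinearMap.mk₂ R brakW
    (fun x x' y => by simp only [brakW, ← catL_apply, map_add, LinearMap.add_apply]; abel)
    (fun c x y => by simp only [brakW, ← catL_apply, map_smul, LinearMap.smul_apply, smul_sub])
    (fun x y y' => by simp only [brakW, ← catL_apply, map_add, LinearMap.add_apply]; abel)
    (fun c x y => by simp only [brakW, ← catL_apply, map_smul, LinearMap.smul_apply, smul_sub])

theorem brakL_apply (x y : FW R) : brakL R x y = brakW x y := rfl

theorem brakW_jacobi (x y z : FW R) :
    brakW (brakW x y) z = brakW (brakW x z) y + brakW x (brakW y z) := by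
  simp only [brakW, ← catL_apply, map_sub, LinearMap.sub_apply]
  simp only [catL_apply, catW_assoc]
  abel

theorem brakW_swap (x y : FW R) : brakW y x = -brakW x y := by
  simp only [brakW, neg_sub]

theorem brakW_zero_left (x : FW R) : brakW 0 x = 0 := by
  rw [← brakL_apply, map_zero, LinearMap.zero_apply]

theorem brakW_zero_right (x : FW R) : brakW x 0 = 0 := by
  rw [← brakL_apply, map_zero]

section SplitSums

variable {M : Type*} [AddCommMonoid M]

theorem sum_powerset_swap (f : Finset ℕ → Finset ℕ → M) (A : Finset ℕ) :
    ∑ P ∈ A.powerset, f P (A \ P) = ∑ P ∈ A.powerset, f (A \ P) P := by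
  refine Finset.sum_nbij' (A \ ·) (A \ ·) ?_ ?_ ?_ ?_ ?_ <;>
    simp +contextual [Finset.sdiff_subset]

theorem sum_powerset_assoc (f : Finset ℕ → Finset ℕ → Finset ℕ → M) (A : Finset ℕ) :
    ∑ P ∈ A.powerset, ∑ Q ∈ P.powerset, f Q (P \ Q) (A \ P) =
      ∑ Q ∈ A.powerset, ∑ S ∈ (A \ Q).powerset, f Q S ((A \ Q) \ S) := by
  rw [Finset.sum_sigma', Finset.sum_sigma']
  refine Finset.sum_nbij' (fun x => ⟨x.2, x.1 \ x.2⟩) (fun x => ⟨x.1 ∪ x.2, x.1⟩) ?_ ?_ ?_ ?_ ?_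
  · rintro ⟨P, Q⟩ h
    simp only [Finset.mem_sigma, Finset.mem_powerset] at h ⊢
    exact ⟨h.2.trans h.1, Finset.sdiff_subset_sdiff h.1 le_rfl⟩
  · rintro ⟨Q, S⟩ h
    simp only [Finset.mem_sigma, Finset.mem_powerset] at h ⊢
    exact ⟨Finset.union_subset h.1 (h.2.trans Finset.sdiff_subset), Finset.subset_union_left⟩
  · rintro ⟨P, Q⟩ h
    simp only [Finset.mem_sigma, Finset.mem_powerset] at h
    simp [Finset.union_sdiff_of_subset h.2]
  · rintro ⟨Q, S⟩ h
    simp only [Finset.mem_sigma, Finset.mem_powerset, Finset.subset_sdiff] at h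
    simp [Finset.union_sdiff_cancel_left h.2.2.symm]
  · rintro ⟨P, Q⟩ h
    simp only [Finset.mem_sigma, Finset.mem_powerset] at h
    have : A \ P = (A \ Q) \ (P \ Q) := by
      rw [sdiff_sdiff_left, Finset.sup_eq_union, Finset.union_sdiff_of_subset h.2]
    simp [this]

end SplitSums

open Classical in
/-- For `f` and `g` indexed by finite sets of labels: the sum of the brackets `[f P, g Q]` over
the splittings `A = P ⊔ Q` satisfying `κ P Q`. -/
noncomputable def splitBrak (κ : Finset ℕ → Finset ℕ → Prop) (f g : Finset ℕ → FW R) :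
    Finset ℕ → FW R := fun A =>
  ∑ P ∈ A.powerset, if κ P (A \ P) then brakW (f P) (g (A \ P)) else 0

theorem splitBrak_eq_add {κ κ₁ κ₂ : Finset ℕ → Finset ℕ → Prop} {f g : Finset ℕ → FW R}
    (hf : f ∅ = 0) (hor : ∀ P Q, κ P Q ↔ κ₁ P Q ∨ κ₂ P Q)
    (hand : ∀ P Q, P.Nonempty → Disjoint P Q → κ₁ P Q → ¬κ₂ P Q) :
    splitBrak κ f g = splitBrak κ₁ f g + splitBrak κ₂ f g := by
  classical
  funext A
  simp only [splitBrak, Pi.add_apply, ← Finset.sum_add_distrib]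
  refine Finset.sum_congr rfl fun P _ => ?_
  rcases P.eq_empty_or_nonempty with rfl | hP
  · simp [hf, brakW_zero_left]
  · have := hand P (A \ P) hP disjoint_sdiff_self_right
    by_cases h₁ : κ₁ P (A \ P) <;> by_cases h₂ : κ₂ P (A \ P) <;> simp_all

theorem splitBrak_swap (κ : Finset ℕ → Finset ℕ → Prop) (f g : Finset ℕ → FW R) :
    splitBrak κ f g = -splitBrak (fun P Q => κ Q P) g f := by
  classical
  funext A
  simp only [splitBrak, Pi.neg_apply]
  rw [sum_powerset_swap fun P Q => if κ P Q then brakW (f P) (g Q) else 0,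
    ← Finset.sum_neg_distrib]
  refine Finset.sum_congr rfl fun P _ => ?_
  split_ifs
  · rw [brakW_swap]
  · simp

open Classical in
theorem splitBrak_splitBrak_left (κ μ : Finset ℕ → Finset ℕ → Prop) (f g h : Finset ℕ → FW R)
    (A : Finset ℕ) :
    splitBrak κ (splitBrak μ f g) h A = ∑ Q ∈ A.powerset, ∑ S ∈ (A \ Q).powerset,
      if μ Q S ∧ κ (Q ∪ S) ((A \ Q) \ S) then
        brakW (brakW (f Q) (g S)) (h ((A \ Q) \ S)) else 0 := by
  rw [← sum_powerset_assoc fun Q S B =>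
    if μ Q S ∧ κ (Q ∪ S) B then brakW (brakW (f Q) (g S)) (h B) else 0]
  refine Finset.sum_congr rfl fun P _ => ?_
  have hP : ∀ Q ∈ P.powerset, (if μ Q (P \ Q) ∧ κ (Q ∪ P \ Q) (A \ P) then
      brakW (brakW (f Q) (g (P \ Q))) (h (A \ P)) else 0) = if κ P (A \ P) then
        (if μ Q (P \ Q) then brakW (brakW (f Q) (g (P \ Q))) (h (A \ P)) else 0) else 0 := by
    intro Q hQ
    rw [Finset.union_sdiff_of_subset (Finset.mem_powerset.1 hQ), ← ite_and]
    simp only [and_comm]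
  rw [Finset.sum_congr rfl hP]
  by_cases hκ : κ P (A \ P)
  · simp only [hκ, if_true, splitBrak, ← brakL_apply, map_sum, LinearMap.sum_apply]
    refine Finset.sum_congr rfl fun Q _ => ?_
    split_ifs <;> simp
  · simp [hκ]

open Classical in
theorem splitBrak_splitBrak_right (κ μ : Finset ℕ → Finset ℕ → Prop) (f g h : Finset ℕ → FW R)
    (A : Finset ℕ) :
    splitBrak κ f (splitBrak μ g h) A = ∑ Q ∈ A.powerset, ∑ S ∈ (A \ Q).powerset,
      if μ S ((A \ Q) \ S) ∧ κ Q (S ∪ (A \ Q) \ S) then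
        brakW (f Q) (brakW (g S) (h ((A \ Q) \ S))) else 0 := by
  refine Finset.sum_congr rfl fun Q _ => ?_
  have hQ : ∀ S ∈ (A \ Q).powerset, (if μ S ((A \ Q) \ S) ∧ κ Q (S ∪ (A \ Q) \ S) then
      brakW (f Q) (brakW (g S) (h ((A \ Q) \ S))) else 0) = if κ Q (A \ Q) then
        (if μ S ((A \ Q) \ S) then brakW (f Q) (brakW (g S) (h ((A \ Q) \ S))) else 0)
          else 0 := by
    intro S hS
    rw [Finset.union_sdiff_of_subset (Finset.mem_powerset.1 hS), ← ite_and]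
    simp only [and_comm]
  rw [Finset.sum_congr rfl hQ]
  by_cases hκ : κ Q (A \ Q)
  · simp only [hκ, if_true, splitBrak, ← brakL_apply, map_sum]
    refine Finset.sum_congr rfl fun S _ => ?_
    split_ifs <;> simp
  · simp [hκ]

/-- The splitting has its minimum on the left. -/
def MinLeft (P Q : Finset ℕ) : Prop := P.min ≤ Q.min

/-- The splitting has its maximum on the left. -/
def MaxLeft (P Q : Finset ℕ) : Prop := Q.max ≤ P.max

/-- The splitting has its minimum on the left and its maximum on the right. -/
def MinMax (P Q : Finset ℕ) : Prop := P.min ≤ Q.min ∧ P.max ≤ Q.max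

/-- The splitting has both its minimum and its maximum on the left. -/
def Outer (P Q : Finset ℕ) : Prop := P.min ≤ Q.min ∧ Q.max ≤ P.max

theorem splitBrak_outer_minMax (f g h : Finset ℕ → FW R) :
    splitBrak Outer (splitBrak MinMax f g) h =
      splitBrak MinMax (splitBrak MinLeft f h) g +
        splitBrak MinMax f (splitBrak MaxLeft g h) := by
  classical
  funext A
  rw [Pi.add_apply, splitBrak_splitBrak_left, splitBrak_splitBrak_left,
    splitBrak_splitBrak_right, ← Finset.sum_add_distrib]
  refine Finset.sum_congr rfl fun Q _ => ?_
  rw [sum_powerset_swap fun S B => if MinLeft Q S ∧ MinMax (Q ∪ S) B then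
    brakW (brakW (f Q) (h S)) (g B) else 0, ← Finset.sum_add_distrib]
  refine Finset.sum_congr rfl fun S _ => ?_
  generalize (A \ Q) \ S = B
  have h₁ : (MinMax Q S ∧ Outer (Q ∪ S) B) ↔ (MinLeft Q B ∧ MinMax (Q ∪ B) S) := by
    simp only [MinMax, Outer, MinLeft, Finset.min_union, Finset.max_union, inf_le_iff, sup_le_iff,
      le_sup_iff]
    grind
  have h₂ : (MinMax Q S ∧ Outer (Q ∪ S) B) ↔ (MaxLeft S B ∧ MinMax Q (S ∪ B)) := by
    simp only [MinMax, Outer, MaxLeft, Finset.min_union, Finset.max_union, inf_le_iff, le_inf_iff,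
      le_sup_iff]
    grind
  rw [brakW_jacobi]
  simp only [← h₁, ← h₂]
  split_ifs <;> simp

theorem Finset.Nonempty.min_ne_of_disjoint {P Q : Finset ℕ} (hP : P.Nonempty)
    (h : Disjoint P Q) : P.min ≠ Q.min := by
  obtain ⟨a, ha⟩ := Finset.min_of_nonempty hP
  exact fun e => Finset.disjoint_left.1 h (Finset.mem_of_min ha) (Finset.mem_of_min (e ▸ ha))

theorem Finset.Nonempty.max_ne_of_disjoint {P Q : Finset ℕ} (hP : P.Nonempty)
    (h : Disjoint P Q) : P.max ≠ Q.max := by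
  obtain ⟨a, ha⟩ := Finset.max_of_nonempty hP
  exact fun e => Finset.disjoint_left.1 h (Finset.mem_of_max ha) (Finset.mem_of_max (e ▸ ha))

theorem splitBrak_min (f g : Finset ℕ → FW R) (hf : f ∅ = 0) :
    splitBrak MinLeft f g = splitBrak MinMax f g + splitBrak Outer f g :=
  splitBrak_eq_add hf (fun P Q => by simp only [MinMax, Outer, MinLeft, ← and_or_left, le_total, and_true])
    fun _ _ hP hPQ h₁ h₂ => hP.max_ne_of_disjoint hPQ (h₁.2.antisymm h₂.2)

theorem splitBrak_max (f g : Finset ℕ → FW R) (hf : f ∅ = 0) :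
    splitBrak MaxLeft f g = splitBrak Outer f g - splitBrak MinMax g f := by
  rw [sub_eq_add_neg, splitBrak_swap MinMax, neg_neg]
  exact splitBrak_eq_add hf
    (fun P Q => by simp only [MinMax, Outer, MaxLeft, ← or_and_right, le_total, true_and])
    fun _ _ hP hPQ h₁ h₂ => hP.min_ne_of_disjoint hPQ (h₁.1.antisymm h₂.1)

theorem splitBrak_true (f g : Finset ℕ → FW R) (hf : f ∅ = 0) (hg : g ∅ = 0) :
    splitBrak (fun _ _ => True) f g =
      splitBrak MinMax f g + splitBrak Outer f g - splitBrak MinMax g f - splitBrak Outer g f := by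
  rw [← splitBrak_min f g hf, sub_sub, ← splitBrak_min g f hg, splitBrak_swap _ g f,
    sub_neg_eq_add]
  exact splitBrak_eq_add hf (fun P Q => by simp only [MinLeft, le_total])
    fun _ _ hP hPQ h₁ h₂ => hP.min_ne_of_disjoint hPQ (h₁.antisymm h₂)

/-- `splitBrak` as a bilinear map. -/
noncomputable def splitBrakL (R : Type) [CommRing R] (κ : Finset ℕ → Finset ℕ → Prop) :
    (Finset ℕ → FW R) →ₗ[R] (Finset ℕ → FW R) →ₗ[R] Finset ℕ → FW R :=
  LinearMap.mk₂ R (splitBrak κ)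
    (fun f f' g => funext fun A => by
      simp only [splitBrak, Pi.add_apply, ← Finset.sum_add_distrib, ← brakL_apply, map_add,
        LinearMap.add_apply]
      exact Finset.sum_congr rfl fun P _ => by split_ifs <;> simp)
    (fun c f g => funext fun A => by
      simp only [splitBrak, Pi.smul_apply, Finset.smul_sum, ← brakL_apply, map_smul,
        LinearMap.smul_apply, smul_ite, smul_zero])
    (fun f g g' => funext fun A => by
      simp only [splitBrak, Pi.add_apply, ← Finset.sum_add_distrib, ← brakL_apply, map_add]
      exact Finset.sum_congr rfl fun P _ => by split_ifs <;> simp)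
    (fun c f g => funext fun A => by
      simp only [splitBrak, Pi.smul_apply, Finset.smul_sum, ← brakL_apply, map_smul,
        smul_ite, smul_zero])

/-- The analogue of `cElt t` for labellings with an arbitrary set of labels. -/
noncomputable def treeElt (R : Type) [CommRing R] : BT → Finset ℕ → FW R
  | .nil => fun A => if A.card = 1 then Finsupp.single A.toList 1 else 0
  | .nd l r => splitBrak MinMax (treeElt R l) (treeElt R r)

theorem treeElt_eq_zero (t : BT) {A : Finset ℕ} (h : A.card ≠ t.nodes + 1) :
    treeElt R t A = 0 := by
  induction t generalizing A with
  | nil => simp_all [treeElt, BT.nodes]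
  | nd l r hl hr =>
    refine Finset.sum_eq_zero fun P hP => ?_
    have hc := Finset.card_sdiff_add_card_eq_card (Finset.mem_powerset.1 hP)
    by_cases hlP : P.card = l.nodes + 1
    · rw [hr (by simp only [BT.nodes] at h; omega), brakW_zero_right, ite_self]
    · rw [hl hlP, brakW_zero_left, ite_self]

theorem treeElt_empty (t : BT) : treeElt R t ∅ = 0 :=
  treeElt_eq_zero t (by simp)

/-- The span of the families `treeElt R t`, for `t` with `k` nodes. -/
noncomputable def treeSpan (R : Type) [CommRing R] (k : ℕ) : Submodule R (Finset ℕ → FW R) :=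
  Submodule.span R {f | ∃ t : BT, t.nodes = k ∧ f = treeElt R t}

theorem treeElt_mem_treeSpan (t : BT) : treeElt R t ∈ treeSpan R t.nodes :=
  Submodule.subset_span ⟨t, rfl, rfl⟩

theorem splitBrak_minMax_mem_treeSpan {j k n : ℕ} {f g : Finset ℕ → FW R}
    (hf : f ∈ treeSpan R j) (hg : g ∈ treeSpan R k) (hn : n = j + k + 1) :
    splitBrak MinMax f g ∈ treeSpan R n := by
  have h := Submodule.apply_mem_map₂ (splitBrakL R MinMax) hf hg
  rw [treeSpan, treeSpan, Submodule.map₂_span_span] at h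
  refine Submodule.span_mono ?_ h
  rintro _ ⟨_, ⟨s, rfl, rfl⟩, _, ⟨t, rfl, rfl⟩, rfl⟩
  exact ⟨.nd s t, hn.symm, rfl⟩

theorem splitBrak_outer_mem_treeSpan (s t : BT) :
    splitBrak Outer (treeElt R s) (treeElt R t) ∈ treeSpan R (s.nodes + t.nodes + 1) := by
  induction s with
  | nil =>
    convert Submodule.zero_mem _
    funext A
    refine Finset.sum_eq_zero fun P _ => ?_
    split_ifs with hP
    · by_cases hc : P.card = 1
      · obtain ⟨a, rfl⟩ := Finset.card_eq_one.1 hc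
        rcases (A \ {a}).eq_empty_or_nonempty with h | ⟨b, hb⟩
        · rw [h, treeElt_empty, brakW_zero_right]
        · have h₁ := hP.1.trans (Finset.min_le hb)
          have h₂ := (Finset.le_max hb).trans hP.2
          simp only [Finset.min_singleton, Finset.max_singleton, WithTop.coe_le_coe,
            WithBot.coe_le_coe] at h₁ h₂
          simp [le_antisymm h₁ h₂] at hb
      · rw [treeElt_eq_zero _ (by simpa [BT.nodes] using hc), brakW_zero_left]
    · rfl
  | nd x y hx hy =>
    have hmin : splitBrak MinLeft (treeElt R x) (treeElt R t) ∈
        treeSpan R (x.nodes + t.nodes + 1) := by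
      rw [splitBrak_min _ _ (treeElt_empty x)]
      exact add_mem (splitBrak_minMax_mem_treeSpan (treeElt_mem_treeSpan x)
        (treeElt_mem_treeSpan t) rfl) hx
    have hmax : splitBrak MaxLeft (treeElt R y) (treeElt R t) ∈
        treeSpan R (y.nodes + t.nodes + 1) := by
      rw [splitBrak_max _ _ (treeElt_empty y)]
      exact sub_mem hy (splitBrak_minMax_mem_treeSpan (treeElt_mem_treeSpan t)
        (treeElt_mem_treeSpan y) (by omega))
    rw [treeElt, splitBrak_outer_minMax]
    refine add_mem (splitBrak_minMax_mem_treeSpan hmin (treeElt_mem_treeSpan y) ?_)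
      (splitBrak_minMax_mem_treeSpan (treeElt_mem_treeSpan x) hmax ?_) <;>
      simp only [BT.nodes] <;> omega

theorem splitBrak_true_mem_treeSpan (s t : BT) :
    splitBrak (fun _ _ => True) (treeElt R s) (treeElt R t) ∈
      treeSpan R (s.nodes + t.nodes + 1) := by
  rw [splitBrak_true _ _ (treeElt_empty s) (treeElt_empty t)]
  have hts := splitBrak_outer_mem_treeSpan (R := R) t s
  rw [add_comm t.nodes] at hts
  exact sub_mem (sub_mem (add_mem (splitBrak_minMax_mem_treeSpan (treeElt_mem_treeSpan s)
    (treeElt_mem_treeSpan t) rfl) (splitBrak_outer_mem_treeSpan s t))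
    (splitBrak_minMax_mem_treeSpan (treeElt_mem_treeSpan t) (treeElt_mem_treeSpan s)
      (by omega))) hts

/-- The words whose letters are the elements of `A`, each used once. -/
noncomputable def arrangements (A : Finset ℕ) : Finset (List ℕ) := A.toList.permutations.toFinset

theorem mem_arrangements {A : Finset ℕ} {w : List ℕ} :
    w ∈ arrangements A ↔ w.Nodup ∧ w.toFinset = A := by
  rw [arrangements, List.mem_toFinset, List.mem_permutations]
  constructor
  · exact fun h => ⟨h.nodup_iff.2 A.nodup_toList, by
      rw [List.toFinset_eq_of_perm _ _ h, Finset.toList_toFinset]⟩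
  · rintro ⟨h, rfl⟩
    exact List.perm_of_nodup_nodup_toFinset_eq h (Finset.nodup_toList _)
      (Finset.toList_toFinset _).symm

theorem length_of_mem_arrangements {A : Finset ℕ} {w : List ℕ} (h : w ∈ arrangements A) :
    w.length = A.card := by
  rw [mem_arrangements] at h
  rw [← h.2, List.toFinset_card_of_nodup h.1]

theorem permWords_eq_arrangements (n : ℕ) : permWords n = arrangements (Finset.Icc 1 n) := by
  ext w
  have hr : (List.range' 1 n).toFinset = Finset.Icc 1 n := by
    ext i; simp only [List.mem_toFinset, List.mem_range'_1, Finset.mem_Icc]; omega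
  rw [mem_arrangements, permWords, List.mem_toFinset, List.mem_permutations]
  constructor
  · exact fun h => ⟨h.nodup_iff.2 List.nodup_range', by
      rw [List.toFinset_eq_of_perm _ _ h, hr]⟩
  · exact fun h => List.perm_of_nodup_nodup_toFinset_eq h.1 List.nodup_range' (by rw [h.2, hr])

theorem append_mem_arrangements {P Q : Finset ℕ} (h : Disjoint P Q) {u v : List ℕ}
    (hu : u ∈ arrangements P) (hv : v ∈ arrangements Q) : u ++ v ∈ arrangements (P ∪ Q) := by
  rw [mem_arrangements] at *
  obtain ⟨hu, rfl⟩ := hu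
  obtain ⟨hv, rfl⟩ := hv
  refine ⟨hu.append hv fun a ha hb => ?_, List.toFinset_append⟩
  exact Finset.disjoint_left.1 h (List.mem_toFinset.2 ha) (List.mem_toFinset.2 hb)

theorem take_drop_mem_arrangements {A : Finset ℕ} {w : List ℕ} (h : w ∈ arrangements A) (k : ℕ) :
    w.take k ∈ arrangements (w.take k).toFinset ∧
      w.drop k ∈ arrangements (A \ (w.take k).toFinset) := by
  rw [mem_arrangements] at h
  simp only [mem_arrangements, h.1.sublist (List.take_sublist k w),
    h.1.sublist (List.drop_sublist k w), true_and]
  have hd : Disjoint (w.take k).toFinset (w.drop k).toFinset :=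
    Finset.disjoint_left.2 fun a ha hb =>
      List.disjoint_take_drop h.1 le_rfl (List.mem_toFinset.1 ha) (List.mem_toFinset.1 hb)
  rw [← h.2]
  conv_rhs => rw [← List.take_append_drop k w, List.toFinset_append]
  rw [List.take_append_drop k w, Finset.union_sdiff_cancel_left hd]

theorem sum_arrangements_split {M : Type*} [AddCommMonoid M] (f : List ℕ → List ℕ → M)
    (A : Finset ℕ) {k : ℕ} (hk : k ≤ A.card) :
    ∑ w ∈ arrangements A, f (w.take k) (w.drop k) =
      ∑ P ∈ A.powersetCard k, ∑ u ∈ arrangements P, ∑ v ∈ arrangements (A \ P), f u v := by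
  simp only [← Finset.sum_product']
  rw [Finset.sum_sigma']
  refine Finset.sum_nbij' (fun w => ⟨(w.take k).toFinset, w.take k, w.drop k⟩)
    (fun x => x.2.1 ++ x.2.2) ?_ ?_ ?_ ?_ ?_
  · intro w hw
    have h := take_drop_mem_arrangements hw k
    simp only [Finset.mem_sigma, Finset.mem_product, Finset.mem_powersetCard]
    refine ⟨⟨?_, ?_⟩, h⟩
    · rw [← (mem_arrangements.1 hw).2]
      exact fun a ha => List.mem_toFinset.2 (List.mem_of_mem_take (List.mem_toFinset.1 ha))
    · rw [← length_of_mem_arrangements h.1, List.length_take, length_of_mem_arrangements hw,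
        min_eq_left hk]
  · rintro ⟨P, u, v⟩ h
    simp only [Finset.mem_sigma, Finset.mem_product, Finset.mem_powersetCard] at h
    have := append_mem_arrangements disjoint_sdiff_self_right h.2.1 h.2.2
    rwa [Finset.union_sdiff_of_subset h.1.1] at this
  · intro w _
    exact List.take_append_drop k w
  · rintro ⟨P, u, v⟩ h
    simp only [Finset.mem_sigma, Finset.mem_product, Finset.mem_powersetCard] at h
    have hu : u.length = k := by rw [length_of_mem_arrangements h.2.1, h.1.2]
    simp only [List.take_left' hu, List.drop_left' hu, (mem_arrangements.1 h.2.1).2]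
  · intro w _
    rfl

theorem minimum_eq_min_toFinset (w : List ℕ) : w.minimum = w.toFinset.min := by
  induction w with
  | nil => rfl
  | cons a w ih => rw [List.minimum_cons, List.toFinset_cons, Finset.min_insert, ih]

theorem maximum_eq_max_toFinset (w : List ℕ) : w.maximum = w.toFinset.max := by
  induction w with
  | nil => rfl
  | cons a w ih => rw [List.maximum_cons, List.toFinset_cons, Finset.max_insert, ih]

theorem admB_nd (l r : BT) (w : List ℕ) :
    admB (.nd l r) w = true ↔
      admB l (w.take (l.nodes + 1)) = true ∧ admB r (w.drop (l.nodes + 1)) = true ∧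
        MinMax (w.take (l.nodes + 1)).toFinset (w.drop (l.nodes + 1)).toFinset := by
  have hmin : (w.take (l.nodes + 1)).minimum = w.minimum ↔
      (w.take (l.nodes + 1)).toFinset.min ≤ (w.drop (l.nodes + 1)).toFinset.min := by
    conv_lhs => rw [minimum_eq_min_toFinset, minimum_eq_min_toFinset]
    conv_lhs => rhs; rw [← List.take_append_drop (l.nodes + 1) w]
    rw [List.toFinset_append, Finset.min_union, left_eq_inf]
  have hmax : (w.drop (l.nodes + 1)).maximum = w.maximum ↔
      (w.take (l.nodes + 1)).toFinset.max ≤ (w.drop (l.nodes + 1)).toFinset.max := by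
    conv_lhs => rw [maximum_eq_max_toFinset, maximum_eq_max_toFinset]
    conv_lhs => rhs; rw [← List.take_append_drop (l.nodes + 1) w]
    rw [List.toFinset_append, Finset.max_union, right_eq_sup]
  simp only [admB, Bool.and_eq_true, decide_eq_true_eq, hmin, hmax, MinMax, and_assoc]

theorem sum_powerset_eq_sum_powersetCard (t : BT) {M : Type*} [AddCommMonoid M] (A : Finset ℕ)
    (F : Finset ℕ → M) (hF : ∀ P, treeElt R t P = 0 → F P = 0) :
    ∑ P ∈ A.powerset, F P = ∑ P ∈ A.powersetCard (t.nodes + 1), F P := by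
  rw [Finset.powersetCard_eq_filter, Finset.sum_filter_of_ne]
  exact fun P _ h => not_not.1 fun hc => h (hF P (treeElt_eq_zero t hc))

theorem treeElt_eq_sum (t : BT) {A : Finset ℕ} (hA : A.card = t.nodes + 1) :
    treeElt R t A = ∑ w ∈ arrangements A with admB t w = true, evalBT t w := by
  classical
  induction t generalizing A with
  | nil =>
    obtain ⟨a, rfl⟩ := Finset.card_eq_one.1 hA
    have : arrangements {a} = {[a]} := by
      ext w
      rw [arrangements, List.mem_toFinset, List.mem_permutations, Finset.toList_singleton,
        List.perm_singleton, Finset.mem_singleton]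
    simp [treeElt, admB, evalBT, this]
  | nd l r hl hr =>
    simp only [BT.nodes] at hA
    simp only [Finset.sum_filter, admB_nd, evalBT]
    rw [sum_arrangements_split (fun u v => if admB l u = true ∧ admB r v = true ∧
      MinMax u.toFinset v.toFinset then brakW (evalBT l u) (evalBT r v) else 0) A
      (by omega : l.nodes + 1 ≤ A.card), treeElt, splitBrak,
      sum_powerset_eq_sum_powersetCard (R := R) l]
    · refine Finset.sum_congr rfl fun P hP => ?_
      rw [Finset.mem_powersetCard] at hP
      have hc := Finset.card_sdiff_add_card_eq_card hP.1
      rw [hl hP.2, hr (by omega), Finset.sum_filter, Finset.sum_filter]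
      have hcond : ∀ u ∈ arrangements P, ∀ v ∈ arrangements (A \ P),
          (if admB l u = true ∧ admB r v = true ∧ MinMax u.toFinset v.toFinset then
            (brakW (evalBT l u) (evalBT r v) : FW R) else 0) = if MinMax P (A \ P) then
              brakL R (if admB l u = true then evalBT l u else 0)
                (if admB r v = true then evalBT r v else 0) else 0 := by
        intro u hu v hv
        rw [(mem_arrangements.1 hu).2, (mem_arrangements.1 hv).2]
        split_ifs <;> simp_all [brakL_apply, brakW_zero_right]
      rw [Finset.sum_congr rfl fun u hu => Finset.sum_congr rfl (hcond u hu)]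
      split_ifs
      · simp only [← brakL_apply, map_sum, LinearMap.sum_apply]
        exact Finset.sum_comm
      · simp only [Finset.sum_const_zero]
    · intro P hP
      rw [hP, brakW_zero_left, ite_self]

theorem mapDomain_catW (e : ℕ → ℕ) (x y : FW R) :
    (catW x y).mapDomain (List.map e) =
      catW (x.mapDomain (List.map e)) (y.mapDomain (List.map e)) := by
  simp only [← catL_apply, ← Finsupp.lmapDomain_apply R R]
  induction x using Finsupp.induction_linear with
  | zero => simp only [map_zero, LinearMap.zero_apply]
  | add x x' hx hx' => simp only [map_add, LinearMap.add_apply, hx, hx']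
  | single u a =>
  induction y using Finsupp.induction_linear with
  | zero => simp only [map_zero]
  | add y y' hy hy' => simp only [map_add, hy, hy']
  | single v b =>
    simp only [catL_apply, catW_single, Finsupp.lmapDomain_apply, Finsupp.mapDomain_single,
      List.map_append]

theorem evalBT_map (t : BT) (e : ℕ → ℕ) (w : List ℕ) :
    (evalBT t (w.map e) : FW R) = (evalBT t w).mapDomain (List.map e) := by
  induction t generalizing w with
  | nil => simp only [evalBT, Finsupp.mapDomain_single]
  | nd l r hl hr =>
    simp only [evalBT, ← List.map_take, ← List.map_drop, hl, hr, brakW, ← mapDomain_catW]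
    simp only [← Finsupp.lmapDomain_apply R R, map_sub]

theorem minMax_iff (P Q : Finset ℕ) :
    MinMax P Q ↔ (∀ b ∈ Q, ∃ a ∈ P, a ≤ b) ∧ ∀ a ∈ P, ∃ b ∈ Q, a ≤ b := by
  refine and_congr ?_ ?_
  · rw [Finset.min_eq_inf_withTop Q, Finset.le_inf_iff]
    refine forall₂_congr fun b _ => ?_
    rw [Finset.min_eq_inf_withTop P, Finset.inf_le_iff (WithTop.coe_lt_top b)]
    simp
  · rw [Finset.max_eq_sup_withBot P, Finset.sup_le_iff]
    refine forall₂_congr fun b _ => ?_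
    rw [Finset.max_eq_sup_withBot Q, Finset.le_sup_iff (WithBot.bot_lt_coe b)]
    simp

theorem admB_map (t : BT) {e : ℕ → ℕ} {A : Set ℕ} (he : StrictMonoOn e A) {w : List ℕ}
    (hw : ∀ a ∈ w, a ∈ A) : admB t (w.map e) = true ↔ admB t w = true := by
  induction t generalizing w with
  | nil => simp only [admB]
  | nd l r hl hr =>
    have h₁ : ∀ a ∈ w.take (l.nodes + 1), a ∈ A := fun a ha => hw a (List.mem_of_mem_take ha)
    have h₂ : ∀ a ∈ w.drop (l.nodes + 1), a ∈ A := fun a ha => hw a (List.mem_of_mem_drop ha)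
    rw [admB_nd, admB_nd, ← List.map_take, ← List.map_drop, hl h₁, hr h₂]
    refine and_congr_right' (and_congr_right' ?_)
    simp only [minMax_iff, List.mem_toFinset, List.mem_map, forall_exists_index, and_imp,
      forall_apply_eq_imp_iff₂, exists_exists_and_eq_and]
    refine and_congr (forall₂_congr fun b hb => exists_congr fun a => and_congr_right fun ha => ?_)
      (forall₂_congr fun a ha => exists_congr fun b => and_congr_right fun hb => ?_)
    · exact he.le_iff_le (h₁ a ha) (h₂ b hb)
    · exact he.le_iff_le (h₁ a ha) (h₂ b hb)

theorem arrangements_image {e : ℕ → ℕ} {A : Finset ℕ} (he : Set.InjOn e A) :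
    arrangements (A.image e) = (arrangements A).image (List.map e) := by
  ext w
  simp only [Finset.mem_image, mem_arrangements]
  constructor
  · rintro ⟨hw, hA⟩
    have hmem : ∀ b ∈ w, ∃ a ∈ (A : Set ℕ), e a = b := fun b hb => by
      have := List.mem_toFinset.2 hb
      rwa [hA, Finset.mem_image] at this
    have hmap : (w.map (Function.invFunOn e A)).map e = w := by
      rw [List.map_map]
      exact (List.map_congr_left fun b hb => Function.invFunOn_eq (hmem b hb)).trans w.map_id
    have hnd : (w.map (Function.invFunOn e A)).Nodup := List.Nodup.of_map e (by rwa [hmap])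
    refine ⟨_, ⟨hnd, ?_⟩, hmap⟩
    refine Finset.eq_of_subset_of_card_le (fun a ha => ?_) ?_
    · obtain ⟨b, hb, rfl⟩ := List.mem_map.1 (List.mem_toFinset.1 ha)
      exact Function.invFunOn_mem (hmem b hb)
    · rw [List.toFinset_card_of_nodup hnd, List.length_map, ← List.toFinset_card_of_nodup hw, hA,
        Finset.card_image_of_injOn he]
  · rintro ⟨u, ⟨hu, rfl⟩, rfl⟩
    refine ⟨(List.nodup_map_iff_inj_on hu).2 fun a ha b hb => ?_, ?_⟩
    · exact he (by simpa using ha) (by simpa using hb)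
    · ext; simp

/-- The rank of `x` in `A`. -/
def rankIn (A : Finset ℕ) (x : ℕ) : ℕ := (A.filter (· ≤ x)).card

theorem rankIn_strictMonoOn (A : Finset ℕ) : StrictMonoOn (rankIn A) A := by
  intro x _ y hy hxy
  refine Finset.card_lt_card ⟨fun a => ?_, fun h => ?_⟩
  · simp only [Finset.mem_filter]
    exact fun ha => ⟨ha.1, ha.2.trans hxy.le⟩
  · have := h (Finset.mem_filter.2 ⟨hy, le_rfl⟩)
    exact absurd (Finset.mem_filter.1 this).2 (not_le.2 hxy)

theorem image_rankIn (A : Finset ℕ) : A.image (rankIn A) = Finset.Icc 1 A.card := by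
  refine Finset.eq_of_subset_of_card_le (fun a ha => ?_) ?_
  · obtain ⟨x, hx, rfl⟩ := Finset.mem_image.1 ha
    exact Finset.mem_Icc.2 ⟨Finset.card_pos.2 ⟨x, Finset.mem_filter.2 ⟨hx, le_rfl⟩⟩,
      Finset.card_filter_le _ _⟩
  · rw [Finset.card_image_of_injOn (rankIn_strictMonoOn A).injOn]
    simp

theorem stdW_eq_map_rankIn {A : Finset ℕ} {w : List ℕ} (h : w ∈ arrangements A) :
    stdW w = w.map (rankIn A) := by
  obtain ⟨hw, rfl⟩ := mem_arrangements.1 h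
  refine List.map_congr_left fun x _ => ?_
  rw [rankIn, ← List.toFinset_card_of_nodup (hw.filter _), List.toFinset_filter]
  simp

theorem stdW_mem_permWords {A : Finset ℕ} {w : List ℕ} (h : w ∈ arrangements A) :
    stdW w ∈ permWords A.card := by
  rw [permWords_eq_arrangements, ← image_rankIn,
    arrangements_image (rankIn_strictMonoOn A).injOn, stdW_eq_map_rankIn h]
  exact Finset.mem_image_of_mem _ h

theorem map_injOn_words {e : ℕ → ℕ} {A : Set ℕ} (he : Set.InjOn e A) :
    Set.InjOn (List.map e) {w | ∀ a ∈ w, a ∈ A} := by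
  intro u hu v hv h
  induction u generalizing v with
  | nil => exact (List.map_eq_nil_iff.1 h.symm).symm
  | cons a u ih =>
    cases v with
    | nil => simp at h
    | cons b v =>
      simp only [Set.mem_ofPred_eq, List.forall_mem_cons] at hu hv
      simp only [List.map_cons, List.cons.injEq] at h
      rw [he hu.1 hv.1 h.1, ih hu.2 hv.2 h.2]

theorem mem_of_mem_arrangements {A : Finset ℕ} {w : List ℕ} (h : w ∈ arrangements A) :
    ∀ a ∈ w, a ∈ (A : Set ℕ) := fun a ha => by
  rw [← (mem_arrangements.1 h).2]
  simpa using ha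

theorem map_injOn_arrangements {e : ℕ → ℕ} {A : Finset ℕ} (he : Set.InjOn e A) :
    Set.InjOn (List.map e) (arrangements A) :=
  (map_injOn_words he).mono fun _ => mem_of_mem_arrangements

theorem mapDomain_treeElt (t : BT) {e : ℕ → ℕ} {A : Finset ℕ} (he : StrictMonoOn e A)
    (hA : A.card = t.nodes + 1) :
    (treeElt R t A).mapDomain (List.map e) = treeElt R t (A.image e) := by
  rw [treeElt_eq_sum t hA, treeElt_eq_sum t (by rw [Finset.card_image_of_injOn he.injOn, hA]),
    ← Finsupp.lmapDomain_apply R R, map_sum, Finset.sum_filter, Finset.sum_filter,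
    arrangements_image he.injOn, Finset.sum_image (map_injOn_arrangements he.injOn)]
  refine Finset.sum_congr rfl fun w hw => ?_
  simp only [admB_map t he (mem_of_mem_arrangements hw), evalBT_map, Finsupp.lmapDomain_apply]

theorem cElt_eq_treeElt (t : BT) : (cElt t : FW R) = treeElt R t (Finset.Icc 1 (t.nodes + 1)) := by
  rw [treeElt_eq_sum t (by simp), cElt, permWords_eq_arrangements]

theorem catW_mem_supported {P Q : Finset ℕ} (h : Disjoint P Q) {x y : FW R}
    (hx : x ∈ Finsupp.supported R R (arrangements P : Set (List ℕ)))
    (hy : y ∈ Finsupp.supported R R (arrangements Q : Set (List ℕ))) :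
    catW x y ∈ Finsupp.supported R R (arrangements (P ∪ Q) : Set (List ℕ)) := by
  refine sum_mem fun u hu => sum_mem fun v hv => Finsupp.single_mem_supported R _ ?_
  exact append_mem_arrangements h (hx hu) (hy hv)

theorem treeElt_mem_supported (t : BT) (A : Finset ℕ) :
    treeElt R t A ∈ Finsupp.supported R R (arrangements A : Set (List ℕ)) := by
  induction t generalizing A with
  | nil =>
    simp only [treeElt]
    split_ifs
    · refine Finsupp.single_mem_supported R _ (mem_arrangements.2 ?_)
      exact ⟨A.nodup_toList, A.toList_toFinset⟩
    · exact zero_mem _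
  | nd l r hl hr =>
    refine sum_mem fun P hP => ?_
    have hu := Finset.union_sdiff_of_subset (Finset.mem_powerset.1 hP)
    split_ifs
    · refine sub_mem ?_ ?_
      · have := catW_mem_supported disjoint_sdiff_self_right (hl P) (hr (A \ P))
        rwa [hu] at this
      · have := catW_mem_supported disjoint_sdiff_self_left (hr (A \ P)) (hl P)
        rwa [Finset.union_comm, hu] at this
    · exact zero_mem _

theorem cElt_stdW (t : BT) {A : Finset ℕ} (hA : A.card = t.nodes + 1) {w : List ℕ}
    (hw : w ∈ arrangements A) : (cElt t : FW R) (stdW w) = treeElt R t A w := by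
  rw [cElt_eq_treeElt, ← hA, ← image_rankIn, ← mapDomain_treeElt t (rankIn_strictMonoOn A) hA,
    stdW_eq_map_rankIn hw]
  exact Finsupp.mapDomain_apply' _ _ (treeElt_mem_supported t A)
    (map_injOn_arrangements (rankIn_strictMonoOn A).injOn) hw

theorem catW_eq_sum {S T : Finset (List ℕ)} {x y : FW R}
    (hx : x ∈ Finsupp.supported R R (S : Set (List ℕ)))
    (hy : y ∈ Finsupp.supported R R (T : Set (List ℕ))) :
    catW x y = ∑ u ∈ S, ∑ v ∈ T, Finsupp.single (u ++ v) (x u * y v) := by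
  rw [catW, Finsupp.sum_of_support_subset x (by exact_mod_cast hx) _ (by simp)]
  refine Finset.sum_congr rfl fun u _ => ?_
  rw [Finsupp.sum_of_support_subset y (by exact_mod_cast hy) _ (by simp)]

theorem starW_eq_sum {m n : ℕ} {x y : FW R}
    (hx : x ∈ Finsupp.supported R R (permWords m : Set (List ℕ)))
    (hy : y ∈ Finsupp.supported R R (permWords n : Set (List ℕ))) :
    starW x y = ∑ w ∈ permWords (m + n),
      Finsupp.single w (x (stdW (w.take m)) * y (stdW (w.drop m))) := by
  have hlen {k : ℕ} {w : List ℕ} (h : w ∈ permWords k) : w.length = k := by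
    rw [permWords_eq_arrangements] at h
    simpa using length_of_mem_arrangements h
  have hconv : starW x y = ∑ u ∈ permWords m, ∑ v ∈ permWords n, ∑ w ∈ permWords (m + n),
      if stdW (w.take m) = u ∧ stdW (w.drop m) = v then Finsupp.single w (x u * y v) else 0 := by
    rw [starW, Finsupp.sum_of_support_subset x (by exact_mod_cast hx) _ (by simp)]
    refine Finset.sum_congr rfl fun u hu => ?_
    rw [Finsupp.sum_of_support_subset y (by exact_mod_cast hy) _ (by simp)]
    refine Finset.sum_congr rfl fun v hv => ?_
    rw [convW, hlen hu, hlen hv, Finset.sum_filter, Finset.smul_sum]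
    simp only [smul_ite, smul_zero, Finsupp.smul_single, smul_eq_mul, mul_one]
  rw [hconv, Finset.sum_congr rfl fun u _ => Finset.sum_comm, Finset.sum_comm]
  refine Finset.sum_congr rfl fun w hw => ?_
  have hlw := hlen hw
  rw [permWords_eq_arrangements] at hw
  have hs := take_drop_mem_arrangements hw m
  have h₁ := stdW_mem_permWords hs.1
  have h₂ := stdW_mem_permWords hs.2
  rw [← length_of_mem_arrangements hs.1, List.length_take, hlw, min_eq_left (by omega)] at h₁
  rw [← length_of_mem_arrangements hs.2, List.length_drop, hlw, Nat.add_sub_cancel_left] at h₂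
  rw [Finset.sum_eq_single_of_mem _ h₁, Finset.sum_eq_single_of_mem _ h₂, if_pos ⟨rfl, rfl⟩]
  · exact fun v _ hv => if_neg fun h => hv h.2.symm
  · exact fun u _ hu => Finset.sum_eq_zero fun v _ => if_neg fun h => hu h.1.symm

theorem cElt_mem_supported (t : BT) :
    (cElt t : FW R) ∈ Finsupp.supported R R (permWords (t.nodes + 1) : Set (List ℕ)) := by
  rw [cElt_eq_treeElt, permWords_eq_arrangements]
  exact treeElt_mem_supported _ _

theorem starW_cElt (s t : BT) :
    starW (cElt s : FW R) (cElt t) =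
      ∑ P ∈ (Finset.Icc 1 (s.nodes + t.nodes + 2)).powerset,
        catW (treeElt R s P) (treeElt R t (Finset.Icc 1 (s.nodes + t.nodes + 2) \ P)) := by
  rw [starW_eq_sum (cElt_mem_supported s) (cElt_mem_supported t), permWords_eq_arrangements,
    show s.nodes + 1 + (t.nodes + 1) = s.nodes + t.nodes + 2 by omega]
  have hc : (Finset.Icc 1 (s.nodes + t.nodes + 2)).card = s.nodes + t.nodes + 2 := by simp
  generalize Finset.Icc 1 (s.nodes + t.nodes + 2) = A at hc
  rw [sum_powerset_eq_sum_powersetCard (R := R) s A]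
  · have h := sum_arrangements_split (fun u v => Finsupp.single (u ++ v)
      ((cElt s : FW R) (stdW u) * (cElt t : FW R) (stdW v))) A
      (by omega : s.nodes + 1 ≤ A.card)
    simp only [List.take_append_drop] at h
    rw [h]
    refine Finset.sum_congr rfl fun P hP => ?_
    rw [Finset.mem_powersetCard] at hP
    have hPc := Finset.card_sdiff_add_card_eq_card hP.1
    rw [catW_eq_sum (treeElt_mem_supported s P) (treeElt_mem_supported t (A \ P))]
    refine Finset.sum_congr rfl fun u hu => Finset.sum_congr rfl fun v hv => ?_
    rw [cElt_stdW s hP.2 hu, cElt_stdW t (by omega) hv]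
  · intro P hP
    rw [hP, ← catL_apply, map_zero, LinearMap.zero_apply]

theorem starW_cElt_sub (s t : BT) :
    starW (cElt s : FW R) (cElt t) - starW (cElt t) (cElt s) =
      splitBrak (fun _ _ => True) (treeElt R s) (treeElt R t)
        (Finset.Icc 1 (s.nodes + t.nodes + 2)) := by
  rw [starW_cElt s t, starW_cElt t s, add_comm t.nodes s.nodes,
    sum_powerset_swap fun P Q => catW (treeElt R t P) (treeElt R s Q), ← Finset.sum_sub_distrib]
  simp only [splitBrak, if_true, brakW]

theorem treeSpan_apply_mem {k : ℕ} {f : Finset ℕ → FW R} (hf : f ∈ treeSpan R k) :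
    f (Finset.Icc 1 (k + 1)) ∈
      Submodule.span R {x : FW R | ∃ t : BT, t.nodes = k ∧ x = cElt t} := by
  have h := Submodule.mem_map_of_mem
    (f := LinearMap.proj (R := R) (φ := fun _ : Finset ℕ => FW R) (Finset.Icc 1 (k + 1))) hf
  rw [treeSpan, Submodule.map_span] at h
  refine Submodule.span_mono ?_ h
  rintro _ ⟨_, ⟨t, rfl, rfl⟩, rfl⟩
  exact ⟨t, rfl, (cElt_eq_treeElt t).symm⟩

theorem stmt11 : ∀ t1 t2 : BT,
    starW (cElt t1 : FW ℚ) (cElt t2) - starW (cElt t2) (cElt t1)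
      ∈ Submodule.span ℚ {x : FW ℚ | ∃ t : BT, t.nodes = t1.nodes + t2.nodes + 1 ∧ x = cElt t} := by
  intro t1 t2
  rw [starW_cElt_sub]
  exact treeSpan_apply_mem (splitBrak_true_mem_treeSpan t1 t2)
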